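/- Correlation of a symmetric convex spherical body with a codimension-one tube: let K₀ ⊆ ℝ^n be a bounded symmetric convex set with nonempty interior, K = q(K₀), let u ∈ ℝ^{n+1} be a unit vector with ⟨u, o⟩ = 0, and let ε ∈ (0, π/2]. Let T = {y ∈ S^n : |⟨y,u⟩| ≤ sin ε} be the ε-tube around the great hypersphere S^n ∩ u^⊥ through o. Then μ_n(K ∩ T) / μ_n(K) ≥ μ_n(T) / μ_n(S^n). -/

import Mathlib

open MeasureTheory Real
open scoped RealInnerProductSpace ENNReal

/-- Density (up to constant) of the Cauchy measure on `ℝⁿ`. -/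
noncomputable def cauchyDensity (n : ℕ) (x : EuclideanSpace ℝ (Fin n)) : ℝ :=
  (1 + ‖x‖ ^ 2) ^ (-(((n : ℝ) + 1) / 2))

/-- Normalizing constant of the Cauchy measure. -/
noncomputable def cauchyConst (n : ℕ) : ℝ :=
  (∫ x : EuclideanSpace ℝ (Fin n), cauchyDensity n x)⁻¹

/-- The Cauchy measure `ν_n` on `ℝⁿ`. -/
noncomputable def cauchyMeasure (n : ℕ) : Measure (EuclideanSpace ℝ (Fin n)) :=
  volume.withDensity fun x => ENNReal.ofReal (cauchyConst n * cauchyDensity n x)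

/-- Gnomonic projection of `ℝⁿ` onto the open upper hemisphere of `Sⁿ ⊆ ℝ^{n+1}`. -/
noncomputable def gnomonic (n : ℕ) (x : EuclideanSpace ℝ (Fin n)) :
    EuclideanSpace ℝ (Fin (n + 1)) :=
  (Real.sqrt (1 + ‖x‖ ^ 2))⁻¹ •
    ((EuclideanSpace.equiv (Fin (n + 1)) ℝ).symm (Fin.snoc (fun i => x i) 1))

/-- The pole `o = e_{n+1}`. -/
noncomputable def pole (n : ℕ) : EuclideanSpace ℝ (Fin (n + 1)) :=
  EuclideanSpace.single (Fin.last n) 1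

/-- The unit sphere `Sⁿ ⊆ ℝ^{n+1}` as a set. -/
noncomputable def unitSphereSet (n : ℕ) : Set (EuclideanSpace ℝ (Fin (n + 1))) :=
  Metric.sphere 0 1

/-- The open hemisphere `Sⁿ₊` centered at the pole. -/
noncomputable def hemisphere (n : ℕ) : Set (EuclideanSpace ℝ (Fin (n + 1))) :=
  {y ∈ unitSphereSet n | 0 < ⟪y, pole n⟫}

theorem volume_real_image_affine (a c : ℝ) (ha : 0 < a) (s : Set ℝ) :
    volume ((fun x => a * x + c) '' s) = ENNReal.ofReal a * volume s := by
  have : (fun x => a * x + c) '' s = (fun x => x + c) '' ((fun x => a * x) '' s) := by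
    rw [Set.image_image]
  have h2 : (fun x => a * x) '' s = (fun x => a⁻¹ * x) ⁻¹' s := by
    ext y
    constructor
    · rintro ⟨x, hx, rfl⟩
      simpa [inv_mul_cancel_left₀ ha.ne'] using hx
    · exact fun hy => ⟨a⁻¹ * y, hy, mul_inv_cancel_left₀ ha.ne' y⟩
  rw [this, Set.image_add_right, measure_preimage_add_right, h2,
    Real.volume_preimage_mul_left (inv_ne_zero ha.ne'), inv_inv, abs_of_pos ha]

theorem brunn_minkowski_real_of_isCompact {a b : ℝ} (ha : 0 < a) (hb : 0 < b) {A B S : Set ℝ}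
    (hA : IsCompact A) (hB : IsCompact B) (hA0 : A.Nonempty) (hB0 : B.Nonempty)
    (H : ∀ x ∈ A, ∀ y ∈ B, a * x + b * y ∈ S) :
    ENNReal.ofReal a * volume A + ENNReal.ofReal b * volume B ≤ volume S := by
  obtain ⟨M, hM, hM'⟩ := hA.exists_isGreatest hA0
  obtain ⟨m, hm, hm'⟩ := hB.exists_isLeast hB0
  set U := (fun x => a * x + b * m) '' A with hU
  set V := (fun y => b * y + a * M) '' B with hV
  have hUV : volume (U ∩ V) = 0 := by
    refine measure_mono_null (t := {a * M + b * m}) ?_ (measure_singleton _)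
    rintro _ ⟨⟨x, hx, rfl⟩, ⟨y, hy, hxy⟩⟩
    have h1 := hM' hx
    have h2 := hm' hy
    simp only [Set.mem_singleton_iff] at hxy ⊢
    nlinarith
  have hVm : MeasurableSet V := (hB.image (by fun_prop)).measurableSet
  rw [← volume_real_image_affine a (b * m) ha, ← volume_real_image_affine b (a * M) hb,
    ← measure_union_add_inter U hVm, hUV, add_zero]
  apply measure_mono
  rintro _ (⟨x, hx, rfl⟩ | ⟨y, hy, rfl⟩)
  · exact H x hx m hm
  · simpa [add_comm] using H M hM y hy

theorem brunn_minkowski_real {a b : ℝ} (ha : 0 < a) (hb : 0 < b) {A B S : Set ℝ}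
    (hA : MeasurableSet A) (hB : MeasurableSet B) (hA0 : A.Nonempty) (hB0 : B.Nonempty)
    (H : ∀ x ∈ A, ∀ y ∈ B, a * x + b * y ∈ S) :
    ENNReal.ofReal a * volume A + ENNReal.ofReal b * volume B ≤ volume S := by
  obtain ⟨x₀, hx₀⟩ := hA0
  obtain ⟨y₀, hy₀⟩ := hB0
  rw [hA.measure_eq_iSup_isCompact volume, hB.measure_eq_iSup_isCompact volume]
  simp only [ENNReal.mul_iSup, iSup_and']
  refine ENNReal.biSup_add_biSup_le' ⟨∅, by simp⟩ ⟨∅, by simp⟩ ?_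
  rintro K ⟨hKA, hK⟩ L ⟨hLB, hL⟩
  refine le_trans ?_ (brunn_minkowski_real_of_isCompact (A := insert x₀ K) (B := insert y₀ L)
    ha hb (hK.insert _) (hL.insert _) ⟨_, Set.mem_insert _ _⟩ ⟨_, Set.mem_insert _ _⟩
    fun x hx y hy => H x (Set.insert_subset hx₀ hKA hx) y (Set.insert_subset hy₀ hLB hy))
  gcongr <;> exact Set.subset_insert _ _

theorem lintegral_eq_lintegral_meas_lt_Ioo {F : ℝ → ℝ} (hF : Measurable F) (h0 : ∀ x, 0 ≤ F x)
    (h1 : ∀ x, F x ≤ 1) :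
    ∫⁻ x, ENNReal.ofReal (F x) = ∫⁻ t in Set.Ioo (0 : ℝ) 1, volume {x | t < F x} := by
  rw [lintegral_eq_lintegral_meas_lt _ (Filter.Eventually.of_forall h0) hF.aemeasurable,
    ← Set.Ioo_union_Ici_eq_Ioi zero_lt_one, lintegral_union measurableSet_Ici
      (Set.disjoint_left.2 fun x hx hx' => absurd hx.2 (not_lt.2 hx'))]
  rw [setLIntegral_congr_fun (g := fun _ => 0) measurableSet_Ici, lintegral_zero, add_zero]
  intro t ht
  have : {x | t < F x} = ∅ := by
    ext x
    simpa using (h1 x).trans ht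
  simp [this]

theorem prekopa_leindler_real_of_le_one {a b : ℝ} (ha : 0 < a) (hb : 0 < b) (hab : a + b = 1)
    {F G H : ℝ → ℝ} (hF : Measurable F) (hG : Measurable G) (hH : Measurable H)
    (hF0 : ∀ x, 0 ≤ F x) (hG0 : ∀ x, 0 ≤ G x) (hH0 : ∀ x, 0 ≤ H x)
    (hF1 : ∀ x, F x ≤ 1) (hG1 : ∀ x, G x ≤ 1) (hH1 : ∀ x, H x ≤ 1)
    (hFs : ∀ t < 1, ∃ x, t < F x) (hGs : ∀ t < 1, ∃ x, t < G x)
    (h : ∀ x y, F x ^ a * G y ^ b ≤ H (a * x + b * y)) :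
    ENNReal.ofReal a * (∫⁻ x, ENNReal.ofReal (F x)) +
        ENNReal.ofReal b * (∫⁻ x, ENNReal.ofReal (G x)) ≤ ∫⁻ x, ENNReal.ofReal (H x) := by
  have mono : ∀ F : ℝ → ℝ, Measurable fun t : ℝ => volume {x | t < F x} := fun F =>
    Antitone.measurable fun s t hst => measure_mono fun x hx => lt_of_le_of_lt hst hx
  rw [lintegral_eq_lintegral_meas_lt_Ioo hF hF0 hF1, lintegral_eq_lintegral_meas_lt_Ioo hG hG0 hG1,
    lintegral_eq_lintegral_meas_lt_Ioo hH hH0 hH1,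
    ← lintegral_const_mul _ (mono F), ← lintegral_const_mul _ (mono G),
    ← lintegral_add_left ((mono F).const_mul _)]
  refine setLIntegral_mono' measurableSet_Ioo fun t ht => ?_
  refine brunn_minkowski_real ha hb (measurableSet_lt measurable_const hF)
    (measurableSet_lt measurable_const hG) (hFs t ht.2) (hGs t ht.2) fun x hx y hy => ?_
  refine lt_of_lt_of_le ?_ (h x y)
  have : t = t ^ a * t ^ b := by rw [← Real.rpow_add ht.1, hab, Real.rpow_one]
  rw [this]
  exact mul_lt_mul'' (Real.rpow_lt_rpow ht.1.le hx ha) (Real.rpow_lt_rpow ht.1.le hy hb)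
    (Real.rpow_nonneg ht.1.le _) (Real.rpow_nonneg ht.1.le _)

theorem ENNReal.rpow_mul_rpow_le_weighted {a b : ℝ} (ha : 0 < a) (hb : 0 < b) (hab : a + b = 1)
    (x y : ℝ≥0∞) : x ^ a * y ^ b ≤ ENNReal.ofReal a * x + ENNReal.ofReal b * y := by
  have hpq : (a⁻¹).HolderConjugate b⁻¹ := by
    rw [Real.holderConjugate_iff]
    refine ⟨(one_lt_inv₀ ha).2 (by linarith), by simpa using hab⟩
  refine (ENNReal.young_inequality (x ^ a) (y ^ b) hpq).trans_eq ?_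
  rw [← ENNReal.rpow_mul, ← ENNReal.rpow_mul, mul_inv_cancel₀ ha.ne', mul_inv_cancel₀ hb.ne',
    ENNReal.rpow_one, ENNReal.rpow_one, ENNReal.ofReal_inv_of_pos ha, ENNReal.ofReal_inv_of_pos hb,
    div_eq_mul_inv, div_eq_mul_inv, inv_inv, inv_inv, mul_comm, mul_comm y]

theorem prekopa_leindler_real_of_bounded {a b : ℝ} (ha : 0 < a) (hb : 0 < b) (hab : a + b = 1)
    {f g h : ℝ → ℝ≥0∞} (hf : Measurable f) (hg : Measurable g) (hh : Measurable h)
    (hf' : ⨆ x, f x ≠ ∞) (hg' : ⨆ x, g x ≠ ∞)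
    (H : ∀ x y, f x ^ a * g y ^ b ≤ h (a * x + b * y)) :
    (∫⁻ x, f x) ^ a * (∫⁻ x, g x) ^ b ≤ ∫⁻ x, h x := by
  set A := ⨆ x, f x with hA
  set B := ⨆ x, g x with hB
  rcases eq_or_ne A 0 with hA0 | hA0
  · have : ∀ x, f x = 0 := by simpa [hA] using hA0
    simp [this, ENNReal.zero_rpow_of_pos ha]
  rcases eq_or_ne B 0 with hB0 | hB0
  · have : ∀ x, g x = 0 := by simpa [hB] using hB0
    simp [this, ENNReal.zero_rpow_of_pos hb]
  have exists_lt : ∀ {f : ℝ → ℝ≥0∞}, ⨆ x, f x ≠ 0 → ⨆ x, f x ≠ ∞ → ∀ t < 1,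
      ∃ x, t < (f x / ⨆ x, f x).toReal := by
    intro f h0 h1 t ht
    have h2 : ENNReal.ofReal t * (⨆ x, f x) < ⨆ x, f x := by
      conv_rhs => rw [← one_mul (⨆ x, f x)]
      exact (ENNReal.mul_lt_mul_iff_left h0 h1).2 (by simpa using ht)
    obtain ⟨x, hx⟩ := lt_iSup_iff.1 h2
    refine ⟨x, ?_⟩
    rcases lt_or_ge t 0 with ht0 | ht0
    · exact ht0.trans_le ENNReal.toReal_nonneg
    have hx1 := (ENNReal.lt_div_iff_mul_lt (Or.inl h0) (Or.inl h1)).2 hx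
    refine (ENNReal.ofReal_lt_iff_lt_toReal ht0 ?_).1 hx1
    exact ENNReal.div_ne_top (ne_top_of_le_ne_top h1 (le_iSup f x)) h0
  have hfA : ∀ x, f x / A ≤ 1 := fun x => ENNReal.div_le_of_le_mul (by simpa using le_iSup f x)
  have hgB : ∀ x, g x / B ≤ 1 := fun x => ENNReal.div_le_of_le_mul (by simpa using le_iSup g x)
  set C := A ^ a * B ^ b with hC
  have hC0 : C ≠ 0 := mul_ne_zero (ENNReal.rpow_pos (pos_iff_ne_zero.2 hA0) hf').ne'
    (ENNReal.rpow_pos (pos_iff_ne_zero.2 hB0) hg').ne'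
  have hC1 : C ≠ ∞ := ENNReal.mul_ne_top (ENNReal.rpow_ne_top_of_nonneg ha.le hf')
    (ENNReal.rpow_ne_top_of_nonneg hb.le hg')
  have key := prekopa_leindler_real_of_le_one ha hb hab
    (F := fun x => (f x / A).toReal) (G := fun x => (g x / B).toReal)
    (H := fun x => (min (h x / C) 1).toReal) (by fun_prop) (by fun_prop) (by fun_prop)
    (fun _ => ENNReal.toReal_nonneg) (fun _ => ENNReal.toReal_nonneg)
    (fun _ => ENNReal.toReal_nonneg)
    (fun x => ENNReal.toReal_le_of_le_ofReal zero_le_one (by simpa using hfA x))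
    (fun x => ENNReal.toReal_le_of_le_ofReal zero_le_one (by simpa using hgB x))
    (fun x => ENNReal.toReal_le_of_le_ofReal zero_le_one (by simp)) ?_ ?_ ?_
  · have e1 : ∀ x, ENNReal.ofReal (f x / A).toReal = f x / A := fun x =>
      ENNReal.ofReal_toReal (ne_top_of_le_ne_top ENNReal.one_ne_top (hfA x))
    have e2 : ∀ x, ENNReal.ofReal (g x / B).toReal = g x / B := fun x =>
      ENNReal.ofReal_toReal (ne_top_of_le_ne_top ENNReal.one_ne_top (hgB x))
    have e3 : ∀ x, ENNReal.ofReal (min (h x / C) 1).toReal ≤ h x / C := fun x =>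
      ENNReal.ofReal_toReal_le.trans (min_le_left _ _)
    simp only [e1, e2] at key
    have key2 := (ENNReal.rpow_mul_rpow_le_weighted ha hb hab _ _).trans
      (key.trans (lintegral_mono e3))
    simp only [div_eq_mul_inv] at key2
    rw [lintegral_mul_const _ hf, lintegral_mul_const _ hg, lintegral_mul_const _ hh,
      ENNReal.mul_rpow_of_nonneg _ _ ha.le, ENNReal.mul_rpow_of_nonneg _ _ hb.le,
      ENNReal.inv_rpow, ENNReal.inv_rpow, mul_mul_mul_comm,
      ← ENNReal.mul_inv (Or.inr (ENNReal.rpow_ne_top_of_nonneg hb.le hg'))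
        (Or.inl (ENNReal.rpow_ne_top_of_nonneg ha.le hf'))] at key2
    exact (ENNReal.mul_le_mul_iff_left (ENNReal.inv_ne_zero.2 hC1)
      (ENNReal.inv_ne_top.2 hC0)).1 key2
  · exact exists_lt hA0 hf'
  · exact exists_lt hB0 hg'
  · intro x y
    rw [ENNReal.toReal_rpow, ENNReal.toReal_rpow, ← ENNReal.toReal_mul]
    refine ENNReal.toReal_mono (by simp) (le_min ?_ ?_)
    · rw [ENNReal.div_rpow_of_nonneg _ _ ha.le, ENNReal.div_rpow_of_nonneg _ _ hb.le,
        div_eq_mul_inv, div_eq_mul_inv, mul_mul_mul_comm,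
        ← ENNReal.mul_inv (Or.inr (ENNReal.rpow_ne_top_of_nonneg hb.le hg'))
        (Or.inl (ENNReal.rpow_ne_top_of_nonneg ha.le hf')), ← div_eq_mul_inv]
      gcongr
      exact H x y
    · exact mul_le_one' (ENNReal.rpow_le_one (hfA x) ha.le) (ENNReal.rpow_le_one (hgB y) hb.le)

theorem prekopa_leindler_real {a b : ℝ} (ha : 0 < a) (hb : 0 < b) (hab : a + b = 1)
    {f g h : ℝ → ℝ≥0∞} (hf : Measurable f) (hg : Measurable g) (hh : Measurable h)
    (H : ∀ x y, f x ^ a * g y ^ b ≤ h (a * x + b * y)) :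
    (∫⁻ x, f x) ^ a * (∫⁻ x, g x) ^ b ≤ ∫⁻ x, h x := by
  have trunc : ∀ f : ℝ → ℝ≥0∞, Measurable f →
      ∫⁻ x, f x = ⨆ N : ℕ, ∫⁻ x, min (f x) N := by
    intro f hf
    rw [← lintegral_iSup (f := fun (N : ℕ) x => min (f x) N) (fun N => hf.min measurable_const)
      (fun i j hij x => min_le_min le_rfl (by exact_mod_cast hij))]
    congr 1 with x
    change _ = ⨆ i : ℕ, f x ⊓ (i : ℝ≥0∞)
    rw [← inf_iSup_eq, ENNReal.iSup_natCast, inf_top_eq]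
  have rpow_iSup : ∀ {c : ℝ} (_ : 0 < c) (F : ℕ → ℝ≥0∞), (⨆ N, F N) ^ c = ⨆ N, F N ^ c :=
    fun hc F => (ENNReal.orderIsoRpow _ hc).map_iSup F
  rw [trunc f hf, trunc g hg, rpow_iSup ha, rpow_iSup hb]
  simp only [ENNReal.iSup_mul, ENNReal.mul_iSup]
  refine iSup_le fun N => iSup_le fun M => ?_
  have bdd : ∀ (f : ℝ → ℝ≥0∞) (N : ℕ), ⨆ x, min (f x) N ≠ ∞ := fun f N =>
    ne_top_of_le_ne_top (ENNReal.natCast_ne_top N) (iSup_le fun x => min_le_right _ _)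
  refine prekopa_leindler_real_of_bounded ha hb hab (by fun_prop) (by fun_prop) hh
    (bdd _ _) (bdd _ _) fun x y => le_trans ?_ (H x y)
  gcongr <;> exact min_le_left _ _

theorem lintegral_fin_succ_eq {n : ℕ} {f : (Fin (n + 1) → ℝ) → ℝ≥0∞} (hf : Measurable f) :
    ∫⁻ x, f x = ∫⁻ s : ℝ, ∫⁻ y : Fin n → ℝ, f (Fin.cons s y) := by
  have e := (volume_preserving_piFinSuccAbove (fun _ : Fin (n + 1) => ℝ) 0).symm
  rw [← e.lintegral_comp hf, Measure.volume_eq_prod,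
    lintegral_prod (fun z => f ((MeasurableEquiv.piFinSuccAbove (fun _ => ℝ) 0).symm z))
      (hf.comp e.measurable).aemeasurable]
  simp [MeasurableEquiv.piFinSuccAbove, Fin.insertNthEquiv]

/-- The Prékopa–Leindler inequality. -/
theorem prekopa_leindler_pi {a b : ℝ} (ha : 0 < a) (hb : 0 < b) (hab : a + b = 1) {n : ℕ}
    {f g h : (Fin n → ℝ) → ℝ≥0∞} (hf : Measurable f) (hg : Measurable g) (hh : Measurable h)
    (H : ∀ x y, f x ^ a * g y ^ b ≤ h (a • x + b • y)) :
    (∫⁻ x, f x) ^ a * (∫⁻ x, g x) ^ b ≤ ∫⁻ x, h x := by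
  induction n with
  | zero =>
    simp only [Measure.volume_pi_eq_dirac (0 : Fin 0 → ℝ), lintegral_dirac]
    simpa using H 0 0
  | succ n ih =>
    have hcons : Measurable fun p : ℝ × (Fin n → ℝ) => (Fin.cons p.1 p.2 : Fin (n + 1) → ℝ) := by
      refine measurable_pi_iff.2 fun i => ?_
      refine Fin.cases ?_ (fun j => ?_) i
      · simpa using measurable_fst
      · simpa [Function.comp_def] using (measurable_pi_apply j).comp measurable_snd
    rw [lintegral_fin_succ_eq hf, lintegral_fin_succ_eq hg, lintegral_fin_succ_eq hh]
    refine prekopa_leindler_real ha hb hab (hf.comp hcons).lintegral_prod_right'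
      (hg.comp hcons).lintegral_prod_right' (hh.comp hcons).lintegral_prod_right' fun s t => ?_
    refine ih (hf.comp (hcons.comp measurable_prodMk_left))
      (hg.comp (hcons.comp measurable_prodMk_left))
      (hh.comp (hcons.comp measurable_prodMk_left)) fun x y => ?_
    refine (H (Fin.cons s x) (Fin.cons t y)).trans_eq ?_
    congr 1
    ext i
    refine Fin.cases ?_ (fun j => ?_) i <;> simp

/-- The multiplicative Brunn–Minkowski inequality. -/
theorem brunn_minkowski_pi {a b : ℝ} (ha : 0 < a) (hb : 0 < b) (hab : a + b = 1) {n : ℕ}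
    {A B S : Set (Fin n → ℝ)} (hA : MeasurableSet A) (hB : MeasurableSet B) (hS : MeasurableSet S)
    (H : ∀ x ∈ A, ∀ y ∈ B, a • x + b • y ∈ S) :
    volume A ^ a * volume B ^ b ≤ volume S := by
  have := prekopa_leindler_pi ha hb hab (measurable_one.indicator hA) (measurable_one.indicator hB)
    (measurable_one.indicator hS) fun x y => ?_
  · simpa only [lintegral_indicator_one, hA, hB, hS] using this
  · by_cases hx : x ∈ A
    · by_cases hy : y ∈ B
      · simp [hx, hy, H x hx y hy]
      · simp [hy, hb]
    · simp [hx, ha]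

/-- The Euclidean norm on `Fin n → ℝ`. -/
noncomputable def euclNorm {n : ℕ} (x : Fin n → ℝ) : ℝ := ‖WithLp.toLp 2 x‖

theorem euclNorm_nonneg {n : ℕ} (x : Fin n → ℝ) : 0 ≤ euclNorm x := norm_nonneg _

theorem euclNorm_smul {n : ℕ} (c : ℝ) (x : Fin n → ℝ) : euclNorm (c • x) = |c| * euclNorm x := by
  simp [euclNorm, norm_smul]

theorem euclNorm_add_le {n : ℕ} (x y : Fin n → ℝ) :
    euclNorm (x + y) ≤ euclNorm x + euclNorm y := by
  simpa [euclNorm] using norm_add_le (WithLp.toLp 2 x) (WithLp.toLp 2 y)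

@[fun_prop]
theorem measurable_euclNorm {n : ℕ} : Measurable (euclNorm : (Fin n → ℝ) → ℝ) :=
  (PiLp.continuous_toLp 2 _).norm.measurable

/-- The part of the slice of `C` at height `s` inside the open Euclidean ball of radius `r`. -/
def ballSlice {n : ℕ} (C : Set (ℝ × (Fin n → ℝ))) (s r : ℝ) : Set (Fin n → ℝ) :=
  {x | (s, x) ∈ C ∧ euclNorm x < r}

theorem measurableSet_ballSlice {n : ℕ} {C : Set (ℝ × (Fin n → ℝ))} (hC : MeasurableSet C)
    (s r : ℝ) : MeasurableSet (ballSlice C s r) :=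
  (measurable_prodMk_left hC).inter (measurableSet_lt measurable_euclNorm measurable_const)

theorem ballSlice_eq_empty {n : ℕ} (C : Set (ℝ × (Fin n → ℝ))) (s : ℝ) {r : ℝ} (hr : r ≤ 0) :
    ballSlice C s r = ∅ := by
  ext x
  simp only [ballSlice, Set.mem_ofPred_eq, Set.mem_empty_iff_false, iff_false, not_and, not_lt]
  exact fun _ => hr.trans (euclNorm_nonneg x)

open scoped Pointwise in
theorem volume_ballSlice_eq_mul {n : ℕ} {C : Set (ℝ × (Fin n → ℝ))}
    (hcone : ∀ c : ℝ, 0 < c → ∀ z ∈ C, c • z ∈ C) (s : ℝ) {r : ℝ} (hr : 0 < r) :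
    volume (ballSlice C s r) = ENNReal.ofReal (r ^ n) * volume (ballSlice C (s / r) 1) := by
  have : ballSlice C s r = r • ballSlice C (s / r) 1 := by
    ext x
    rw [Set.mem_smul_set_iff_inv_smul_mem₀ hr.ne']
    simp only [ballSlice, Set.mem_ofPred_eq, euclNorm_smul, abs_of_pos (inv_pos.2 hr)]
    refine and_congr ⟨fun h => ?_, fun h => ?_⟩ ?_
    · simpa [div_eq_inv_mul] using hcone r⁻¹ (inv_pos.2 hr) _ h
    · have := hcone r hr _ h
      rwa [Prod.smul_mk, smul_inv_smul₀ hr.ne', smul_eq_mul, mul_div_cancel₀ _ hr.ne'] at this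
    · rw [inv_mul_lt_iff₀ hr, mul_one]
  rw [this, Measure.addHaar_smul, Module.finrank_fin_fun, abs_of_pos (pow_pos hr n)]

theorem volume_ballSlice_antitone {n : ℕ} {C : Set (ℝ × (Fin n → ℝ))} (hC : MeasurableSet C)
    (hconv : Convex ℝ C) (heven : ∀ s, volume (ballSlice C (-s) 1) = volume (ballSlice C s 1))
    {s t : ℝ} (hst : |s| ≤ |t|) :
    volume (ballSlice C t 1) ≤ volume (ballSlice C s 1) := by
  rcases hst.eq_or_lt with h | h
  · rcases abs_eq_abs.1 h with rfl | rfl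
    · rfl
    · rw [heven]
  have ht : 0 < |t| := (abs_nonneg s).trans_lt h
  have ht0 : t ≠ 0 := abs_pos.1 ht
  obtain ⟨h1, h2⟩ := abs_lt.1 (show |s / t| < 1 by rw [abs_div]; exact (div_lt_one ht).2 h)
  have ha : 0 < (1 + s / t) / 2 := by linarith
  have hb : 0 < (1 - s / t) / 2 := by linarith
  have hab : (1 + s / t) / 2 + (1 - s / t) / 2 = 1 := by ring
  have := brunn_minkowski_pi ha hb hab (measurableSet_ballSlice hC t 1)
    (measurableSet_ballSlice hC (-t) 1) (measurableSet_ballSlice hC s 1) fun x hx y hy => ⟨?_, ?_⟩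
  · rwa [heven, ← ENNReal.rpow_add_of_nonneg _ _ ha.le hb.le, hab, ENNReal.rpow_one] at this
  · have := hconv hx.1 hy.1 ha.le hb.le hab
    simp only [Prod.smul_mk, Prod.mk_add_mk, smul_eq_mul] at this
    convert this using 2
    field_simp
    ring
  · refine (euclNorm_add_le _ _).trans_lt ?_
    rw [euclNorm_smul, euclNorm_smul, abs_of_pos ha, abs_of_pos hb]
    nlinarith [hx.2, hy.2]

/-- The volume of the part of `C` inside the Euclidean unit ball of `ℝ × ℝⁿ`. -/
noncomputable def ballVolume {n : ℕ} (C : Set (ℝ × (Fin n → ℝ))) : ℝ≥0∞ :=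
  volume (C ∩ {z | z.1 ^ 2 + euclNorm z.2 ^ 2 < 1})

/-- The solid double cone `{|s| ≤ a √(s² + |x|²)}` in `ℝ × ℝⁿ`. -/
def solidTube (n : ℕ) (a : ℝ) : Set (ℝ × (Fin n → ℝ)) :=
  {z | |z.1| ≤ a * √(z.1 ^ 2 + euclNorm z.2 ^ 2)}

theorem measurableSet_solidTube (n : ℕ) (a : ℝ) : MeasurableSet (solidTube n a) :=
  measurableSet_le (by fun_prop) (by fun_prop)

theorem ballVolume_eq_lintegral {n : ℕ} {C : Set (ℝ × (Fin n → ℝ))} (hC : MeasurableSet C) :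
    ballVolume C = ∫⁻ s, volume (ballSlice C s √(1 - s ^ 2)) := by
  have hB : MeasurableSet {z : ℝ × (Fin n → ℝ) | z.1 ^ 2 + euclNorm z.2 ^ 2 < 1} :=
    measurableSet_lt (by fun_prop) measurable_const
  rw [ballVolume, Measure.volume_eq_prod, Measure.prod_apply (hC.inter hB)]
  refine lintegral_congr fun s => congrArg _ ?_
  ext x
  simp only [ballSlice, Set.mem_preimage, Set.mem_inter_iff, Set.mem_ofPred_eq,
    Real.lt_sqrt (euclNorm_nonneg x), lt_sub_iff_add_lt']

theorem measurable_volume_ballSlice {n : ℕ} {C : Set (ℝ × (Fin n → ℝ))} (hC : MeasurableSet C)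
    {r : ℝ → ℝ} (hr : Measurable r) : Measurable fun s => volume (ballSlice C s (r s)) := by
  have : MeasurableSet {z : ℝ × (Fin n → ℝ) | z ∈ C ∧ euclNorm z.2 < r z.1} :=
    hC.inter (measurableSet_lt (measurable_euclNorm.comp measurable_snd) (hr.comp measurable_fst))
  exact measurable_measure_prodMk_left this

theorem mem_solidTube_iff {n : ℕ} {a : ℝ} (ha0 : 0 < a) (ha1 : a < 1) (s : ℝ) (x : Fin n → ℝ) :
    (s, x) ∈ solidTube n a ↔ |s| * (√(1 - a ^ 2) / a) ≤ euclNorm x := by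
  have h1 : 0 < 1 - a ^ 2 := by nlinarith
  have hx := euclNorm_nonneg x
  rw [solidTube, Set.mem_ofPred_eq,
    ← abs_of_nonneg (by positivity : 0 ≤ a * √(s ^ 2 + euclNorm x ^ 2)),
    ← sq_le_sq, mul_pow, Real.sq_sqrt (by positivity), mul_div_assoc', div_le_iff₀ ha0,
    ← abs_of_nonneg (by positivity : 0 ≤ |s| * √(1 - a ^ 2)),
    ← abs_of_nonneg (by positivity : 0 ≤ euclNorm x * a), ← sq_le_sq, mul_pow,
    Real.sq_sqrt h1.le, sq_abs]
  constructor <;> intro h <;> nlinarith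

theorem sqrt_one_sub_sq_le_iff {a : ℝ} (ha0 : 0 < a) (ha1 : a < 1) (s : ℝ) :
    √(1 - s ^ 2) ≤ |s| * (√(1 - a ^ 2) / a) ↔ a ≤ |s| := by
  have h1 : 0 < 1 - a ^ 2 := by nlinarith
  rw [Real.sqrt_le_left (by positivity), mul_pow, div_pow, Real.sq_sqrt h1.le, sq_abs,
    mul_div_assoc', le_div_iff₀ (by positivity), ← abs_of_pos ha0, ← sq_le_sq, abs_of_pos ha0]
  constructor <;> intro h <;> nlinarith

theorem ballVolume_inter_solidTube_add {n : ℕ} {C : Set (ℝ × (Fin n → ℝ))} (hC : MeasurableSet C)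
    {a : ℝ} (ha0 : 0 < a) (ha1 : a < 1) :
    ballVolume (C ∩ solidTube n a) +
        ∫⁻ s in {s | |s| < a}, volume (ballSlice C s (|s| * (√(1 - a ^ 2) / a))) =
      ∫⁻ s in {s | |s| < a}, volume (ballSlice C s √(1 - s ^ 2)) := by
  have hI : MeasurableSet {s : ℝ | |s| < a} := measurableSet_lt (by fun_prop) measurable_const
  have hD := hC.inter (measurableSet_solidTube n a)
  rw [ballVolume_eq_lintegral hD, ← lintegral_indicator hI, ← lintegral_indicator hI,
    ← lintegral_add_left (measurable_volume_ballSlice hD (by fun_prop))]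
  refine lintegral_congr fun s => ?_
  by_cases hs : s ∈ {s : ℝ | |s| < a}
  · rw [Set.indicator_of_mem hs, Set.indicator_of_mem hs,
      ← measure_union _ (measurableSet_ballSlice hC _ _)]
    · congr 1
      have h1 := (sqrt_one_sub_sq_le_iff ha0 ha1 s).not.2 (not_le.2 hs)
      ext x
      simp only [ballSlice, Set.mem_union, Set.mem_inter_iff, Set.mem_ofPred_eq,
        mem_solidTube_iff ha0 ha1]
      grind
    · refine Set.disjoint_left.2 fun x hx hx' => ?_
      exact absurd hx'.2 (not_lt.2 ((mem_solidTube_iff ha0 ha1 s x).1 hx.1.2))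
  · rw [Set.indicator_of_notMem hs, Set.indicator_of_notMem hs, add_zero]
    have h1 := (sqrt_one_sub_sq_le_iff ha0 ha1 s).2 (not_lt.1 hs)
    convert measure_empty (μ := volume)
    refine Set.eq_empty_of_forall_notMem fun x hx => ?_
    have := (mem_solidTube_iff ha0 ha1 s x).1 hx.1.2
    exact absurd (hx.2.trans_le (h1.trans this)) (lt_irrefl _)

theorem cross_mul_le_of_slice_bounds {p q b G g₀ x y t t₀ : ℝ≥0∞} (hp : p ≠ ∞) (hq : q ≠ ∞)
    (hb : b ≠ ∞) (hG : G ≠ ∞) (hg₀ : g₀ ≠ ∞) (hx : x ≠ ∞) (ht : t + b * G = x)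
    (ht₀ : t₀ + b * g₀ = p * g₀) (hpx : p * G ≤ x) (hyq : y ≤ q * G) :
    (x + y) * t₀ ≤ t * (p * g₀ + q * g₀) := by
  have hy : y ≠ ∞ := ne_top_of_le_ne_top (ENNReal.mul_ne_top hq hG) hyq
  have htt : t ≠ ∞ := ne_top_of_le_ne_top hx (ht ▸ le_self_add)
  have htt₀ : t₀ ≠ ∞ := ne_top_of_le_ne_top (ENNReal.mul_ne_top hp hg₀) (ht₀ ▸ le_self_add)
  lift p to NNReal using hp
  lift q to NNReal using hq
  lift b to NNReal using hb
  lift G to NNReal using hG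
  lift g₀ to NNReal using hg₀
  lift x to NNReal using hx
  lift y to NNReal using hy
  lift t to NNReal using htt
  lift t₀ to NNReal using htt₀
  norm_cast at *
  rcases eq_or_ne g₀ 0 with rfl | h0
  · have : t₀ = 0 := by simpa using ht₀
    simp [this]
  have ht' : (t : ℝ) = x - b * G := eq_sub_of_add_eq (by exact_mod_cast ht)
  have ht₀' : (t₀ : ℝ) = (p - b) * g₀ := by
    rw [sub_mul]
    exact eq_sub_of_add_eq (by exact_mod_cast ht₀)
  have hbp : b ≤ p := le_of_mul_le_mul_right (ht₀ ▸ le_add_self) (pos_iff_ne_zero.2 h0)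
  rw [← NNReal.coe_le_coe]
  push_cast
  rw [ht', ht₀']
  have e1 : (0 : ℝ) ≤ p - b := sub_nonneg.2 (by exact_mod_cast hbp)
  have e2 : (0 : ℝ) ≤ x - p * G := sub_nonneg.2 (by exact_mod_cast hpx)
  have e3 : (0 : ℝ) ≤ q * G - y := sub_nonneg.2 (by exact_mod_cast hyq)
  have e4 : (0 : ℝ) ≤ g₀ * ((x - p * G) * (q + b) + (p - b) * (q * G - y)) := by positivity
  nlinarith

theorem ballVolume_eq_add {n : ℕ} {C : Set (ℝ × (Fin n → ℝ))} (hC : MeasurableSet C) (a : ℝ) :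
    ballVolume C = (∫⁻ s in {s | |s| < a}, volume (ballSlice C s √(1 - s ^ 2))) +
      ∫⁻ s in {s | |s| < a}ᶜ, volume (ballSlice C s √(1 - s ^ 2)) := by
  rw [ballVolume_eq_lintegral hC,
    lintegral_add_compl _ (measurableSet_lt (by fun_prop) measurable_const)]

theorem volume_ballSlice_ne_top {n : ℕ} (C : Set (ℝ × (Fin n → ℝ))) (s r : ℝ) :
    volume (ballSlice C s r) ≠ ∞ := by
  have h : volume {x : Fin n → ℝ | euclNorm x < r} ≠ ∞ := by
    have := (PiLp.volume_preserving_toLp (Fin n)).measure_preimage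
      (measurableSet_ball (x := (0 : EuclideanSpace ℝ (Fin n))) (ε := r)).nullMeasurableSet
    convert (measure_ball_lt_top (μ := volume) (x := (0 : EuclideanSpace ℝ (Fin n))) (r := r)).ne
      using 1
    rw [← this]
    congr 1
    ext x
    simp [euclNorm]
  exact ne_top_of_le_ne_top h (measure_mono fun x hx => hx.2)

theorem ballVolume_mul_solidTube_le {n : ℕ} (hn : 1 ≤ n) {C : Set (ℝ × (Fin n → ℝ))}
    (hC : MeasurableSet C) (hconv : Convex ℝ C) (hcone : ∀ c : ℝ, 0 < c → ∀ z ∈ C, c • z ∈ C)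
    (heven : ∀ s, volume (ballSlice C (-s) 1) = volume (ballSlice C s 1))
    {a : ℝ} (ha0 : 0 < a) (ha1 : a < 1) :
    ballVolume C * ballVolume (solidTube n a) ≤
      ballVolume (C ∩ solidTube n a) * ballVolume (Set.univ : Set (ℝ × (Fin n → ℝ))) := by
  have hn0 : n ≠ 0 := by omega
  have hI : MeasurableSet {s : ℝ | |s| < a} := measurableSet_lt (by fun_prop) measurable_const
  have hc : 0 < √(1 - a ^ 2) / a := div_pos (Real.sqrt_pos.2 (by nlinarith)) ha0
  set c := √(1 - a ^ 2) / a with hc_def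
  set G := volume (ballSlice C c⁻¹ 1) with hG
  set g₀ := volume (ballSlice (Set.univ : Set (ℝ × (Fin n → ℝ))) 0 1) with hg₀
  have huniv : ∀ s r, 0 ≤ r → volume (ballSlice (Set.univ : Set (ℝ × (Fin n → ℝ))) s r) =
      ENNReal.ofReal (r ^ n) * g₀ := by
    intro s r hr
    rcases hr.eq_or_lt with rfl | hr
    · simp [ballSlice_eq_empty, hn0]
    · rw [volume_ballSlice_eq_mul (fun _ _ _ _ => Set.mem_univ _) s hr]
      simp [hg₀, ballSlice]
  have hL : Measurable fun s : ℝ => ENNReal.ofReal (√(1 - s ^ 2) ^ n) := by fun_prop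
  have hM : Measurable fun s : ℝ => ENNReal.ofReal ((|s| * c) ^ n) := by fun_prop
  have hLfin : ∫⁻ s : ℝ, ENNReal.ofReal (√(1 - s ^ 2) ^ n) ≠ ∞ := by
    refine ne_top_of_le_ne_top (b := ∫⁻ s, (Set.Icc (-1 : ℝ) 1).indicator 1 s) ?_
      (lintegral_mono fun s => ?_)
    · rw [lintegral_indicator_one measurableSet_Icc]
      simp
    · by_cases hs : s ∈ Set.Icc (-1 : ℝ) 1
      · simp only [Set.indicator_of_mem hs, Pi.one_apply, ENNReal.ofReal_le_one]
        exact pow_le_one₀ (Real.sqrt_nonneg _) (Real.sqrt_le_one.2 (by nlinarith))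
      · have : 1 - s ^ 2 ≤ 0 := by
          by_contra h
          exact hs (abs_le.1 (by rw [← sq_le_one_iff_abs_le_one]; linarith))
        simp [Real.sqrt_eq_zero_of_nonpos this, hn0]
  have hp := ne_top_of_le_ne_top hLfin (setLIntegral_le_lintegral {s : ℝ | |s| < a} _)
  have hq := ne_top_of_le_ne_top hLfin (setLIntegral_le_lintegral {s : ℝ | |s| < a}ᶜ _)
  have hb : ∫⁻ s in {s : ℝ | |s| < a}, ENNReal.ofReal ((|s| * c) ^ n) ≠ ∞ := by
    refine ne_top_of_le_ne_top hp (setLIntegral_mono' hI fun s hs => ?_)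
    gcongr
    exact (not_le.1 ((sqrt_one_sub_sq_le_iff ha0 ha1 s).not.2 (not_le.2 hs))).le
  have hslice : ∀ s, s ≠ 0 → volume (ballSlice C s (|s| * c)) =
      ENNReal.ofReal ((|s| * c) ^ n) * G := by
    intro s hs
    rw [volume_ballSlice_eq_mul hcone s (mul_pos (abs_pos.2 hs) hc)]
    rcases abs_choice s with h | h
    · rw [h, ← div_div, div_self hs, one_div]
    · rw [h, ← div_div, div_neg, div_self hs, neg_div, one_div, heven]
  have key := cross_mul_le_of_slice_bounds hp hq hb (volume_ballSlice_ne_top C _ _ : G ≠ ∞)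
    (volume_ballSlice_ne_top _ _ _ : g₀ ≠ ∞)
    (x := ∫⁻ s in {s | |s| < a}, volume (ballSlice C s √(1 - s ^ 2)))
    (y := ∫⁻ s in {s | |s| < a}ᶜ, volume (ballSlice C s √(1 - s ^ 2)))
    (t := ballVolume (C ∩ solidTube n a)) (t₀ := ballVolume (solidTube n a)) ?_ ?_ ?_ ?_ ?_
  · rw [ballVolume_eq_add hC a, ballVolume_eq_add MeasurableSet.univ a]
    simpa only [huniv _ _ (Real.sqrt_nonneg _), lintegral_mul_const _ hL] using key
  · refine ne_top_of_le_ne_top (ENNReal.mul_ne_top hp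
      (volume_ballSlice_ne_top _ _ _ : g₀ ≠ ∞)) ?_
    rw [← lintegral_mul_const _ hL]
    refine lintegral_mono fun s => ?_
    rw [← huniv s _ (Real.sqrt_nonneg _)]
    exact measure_mono fun x hx => ⟨Set.mem_univ _, hx.2⟩
  · rw [← ballVolume_inter_solidTube_add hC ha0 ha1, ← lintegral_mul_const _ hM]
    congr 1
    refine lintegral_congr_ae (ae_restrict_of_ae ?_)
    filter_upwards [Measure.ae_ne volume (0 : ℝ)] with s hs
    exact (hslice s hs).symm
  · have := ballVolume_inter_solidTube_add (n := n) MeasurableSet.univ ha0 ha1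
    simp only [huniv _ _ (Real.sqrt_nonneg _), huniv _ _ (mul_nonneg (abs_nonneg _) hc.le),
      lintegral_mul_const _ hL, lintegral_mul_const _ hM, Set.univ_inter, ← hc_def] at this
    exact this
  · rw [← lintegral_mul_const _ hL]
    refine setLIntegral_mono' hI fun s hs => ?_
    have h1 := not_le.1 ((sqrt_one_sub_sq_le_iff ha0 ha1 s).not.2 (not_le.2 hs))
    have h2 : 0 < √(1 - s ^ 2) := (mul_nonneg (abs_nonneg _) hc.le).trans_lt h1
    rw [volume_ballSlice_eq_mul hcone s h2]
    refine mul_le_mul' le_rfl (volume_ballSlice_antitone hC hconv heven ?_)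
    rw [abs_div, abs_of_pos h2, abs_of_pos (inv_pos.2 hc), ← one_div, div_le_div_iff₀ h2 hc,
      one_mul]
    exact h1.le
  · rw [← lintegral_mul_const _ hL]
    refine setLIntegral_mono' hI.compl fun s hs => ?_
    have h1 := (sqrt_one_sub_sq_le_iff ha0 ha1 s).2 (not_lt.1 hs)
    rcases (Real.sqrt_nonneg (1 - s ^ 2)).eq_or_lt with h2 | h2
    · simp [← h2, ballSlice_eq_empty]
    rw [volume_ballSlice_eq_mul hcone s h2]
    refine mul_le_mul' le_rfl (volume_ballSlice_antitone hC hconv heven ?_)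
    rw [abs_div, abs_of_pos h2, abs_of_pos (inv_pos.2 hc), ← one_div, div_le_div_iff₀ hc h2,
      one_mul]
    exact h1

/-- Two finite measures concentrated on `S`, each giving the same mass to balls of equal radius
centred on `S`, are proportional. -/
theorem measure_mul_univ_eq_of_closedBall_eq {X : Type*} [MetricSpace X] [MeasurableSpace X]
    [BorelSpace X] [SecondCountableTopology X] [HasBesicovitchCovering X] {ρ μ : Measure X}
    [IsFiniteMeasure ρ] [IsFiniteMeasure μ] {S : Set X} (hρ : ρ Sᶜ = 0) (hμ : μ Sᶜ = 0)
    (hρb : ∀ x ∈ S, ∀ y ∈ S, ∀ r, ρ (Metric.closedBall x r) = ρ (Metric.closedBall y r))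
    (hμb : ∀ x ∈ S, ∀ y ∈ S, ∀ r, μ (Metric.closedBall x r) = μ (Metric.closedBall y r))
    (s : Set X) : ρ s * μ Set.univ = ρ Set.univ * μ s := by
  rcases eq_or_ne (ρ + μ) 0 with h0 | h0
  · have hle : ρ ≤ ρ + μ := Measure.le_add_right le_rfl
    have h1 : ∀ t, ρ t = 0 := fun t => by simpa [h0] using hle t
    simp [h1]
  have hlim := Besicovitch.ae_tendsto_rnDeriv ρ (ρ + μ)
  have hS : ∀ᵐ x ∂(ρ + μ), x ∈ S := by
    rw [ae_iff]
    change (ρ + μ) Sᶜ = 0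
    simp [hρ, hμ]
  have : NeZero (ρ + μ) := ⟨h0⟩
  obtain ⟨x₀, hx₀, hx₀S⟩ := (hlim.and hS).exists
  have hconst : ρ.rnDeriv (ρ + μ) =ᵐ[ρ + μ] fun _ => ρ.rnDeriv (ρ + μ) x₀ := by
    filter_upwards [hlim, hS] with x hx hxS
    refine tendsto_nhds_unique hx ?_
    simpa only [Measure.add_apply, hρb x hxS x₀ hx₀S, hμb x hxS x₀ hx₀S] using hx₀
  have hac : ρ ≪ ρ + μ := Measure.absolutelyContinuous_of_le (Measure.le_add_right le_rfl)
  have heq : ρ = ρ.rnDeriv (ρ + μ) x₀ • (ρ + μ) := by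
    conv_lhs => rw [← Measure.withDensity_rnDeriv_eq ρ (ρ + μ) hac,
      withDensity_congr_ae hconst, withDensity_const]
  have h1 : ∀ t, ρ t = ρ.rnDeriv (ρ + μ) x₀ * (ρ t + μ t) := fun t => by
    conv_lhs => rw [heq]
    simp [mul_add]
  have h2 : ρ s * (ρ Set.univ + μ Set.univ) = ρ Set.univ * (ρ s + μ s) := by
    conv_lhs => rw [h1 s]
    conv_rhs => rw [h1 Set.univ]
    ring
  rw [mul_add, mul_add, mul_comm (ρ Set.univ) (ρ s)] at h2
  exact (ENNReal.add_right_inj (ENNReal.mul_ne_top (measure_ne_top _ _) (measure_ne_top _ _))).1 h2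

section Cone

variable {E : Type*} [NormedAddCommGroup E] [InnerProductSpace ℝ E] [FiniteDimensional ℝ E]
  [MeasurableSpace E] [BorelSpace E]

/-- The measure on the unit sphere assigning to a set the volume of the cone over it in the
unit ball. -/
noncomputable def coneMeasure (E : Type*) [NormedAddCommGroup E] [InnerProductSpace ℝ E]
    [FiniteDimensional ℝ E] [MeasurableSpace E] [BorelSpace E] : Measure E :=
  (volume.restrict (Metric.ball (0 : E) 1)).map fun z => ‖z‖⁻¹ • z

instance : IsFiniteMeasure (coneMeasure E) := by
  have : IsFiniteMeasure (volume.restrict (Metric.ball (0 : E) 1)) :=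
    ⟨by simpa using measure_ball_lt_top⟩
  unfold coneMeasure
  infer_instance

theorem measurable_inv_norm_smul : Measurable fun z : E => ‖z‖⁻¹ • z := by fun_prop

theorem coneMeasure_sphere_inter [Nontrivial E] {D : Set E} (hD : MeasurableSet D)
    (hcone : ∀ c : ℝ, 0 < c → ∀ z ∈ D, c • z ∈ D) :
    coneMeasure E (Metric.sphere 0 1 ∩ D) = volume (D ∩ Metric.ball 0 1) := by
  rw [coneMeasure, Measure.map_apply measurable_inv_norm_smul
    (Metric.isClosed_sphere.measurableSet.inter hD),
    Measure.restrict_apply (measurable_inv_norm_smul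
      (Metric.isClosed_sphere.measurableSet.inter hD))]
  refine measure_congr (Filter.EventuallyEq.inter ?_ (ae_eq_refl _))
  filter_upwards [Measure.ae_ne volume (0 : E)] with z hz
  have hz' : 0 < ‖z‖ := norm_pos_iff.2 hz
  refine propext ⟨fun h => ?_, fun h => ⟨?_, ?_⟩⟩
  · have := hcone ‖z‖ hz' _ h.2
    rwa [smul_inv_smul₀ hz'.ne'] at this
  · simp [norm_smul, hz'.ne']
  · exact hcone _ (inv_pos.2 hz') _ h

theorem coneMeasure_compl_sphere [Nontrivial E] :
    coneMeasure E (Metric.sphere 0 1)ᶜ = 0 := by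
  rw [measure_compl Metric.isClosed_sphere.measurableSet (measure_ne_top _ _),
    ← Set.inter_univ (Metric.sphere (0 : E) 1),
    coneMeasure_sphere_inter MeasurableSet.univ fun _ _ _ _ => Set.mem_univ _]
  simp [coneMeasure, Measure.map_apply measurable_inv_norm_smul MeasurableSet.univ]

theorem exists_linearIsometryEquiv_apply_eq {E : Type*} [NormedAddCommGroup E]
    [InnerProductSpace ℝ E] {x y : E} (h : ‖x‖ = ‖y‖) :
    ∃ e : E ≃ₗᵢ[ℝ] E, e x = y :=
  ⟨_, Submodule.reflection_sub h⟩

theorem coneMeasure_closedBall_eq {x y : E} (h : ‖x‖ = ‖y‖) (r : ℝ) :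
    coneMeasure E (Metric.closedBall x r) = coneMeasure E (Metric.closedBall y r) := by
  obtain ⟨e, rfl⟩ := exists_linearIsometryEquiv_apply_eq h
  have hm : ∀ x : E, MeasurableSet ((fun z : E => ‖z‖⁻¹ • z) ⁻¹' Metric.closedBall x r) :=
    fun x => measurable_inv_norm_smul Metric.isClosed_closedBall.measurableSet
  rw [coneMeasure, Measure.map_apply measurable_inv_norm_smul measurableSet_closedBall,
    Measure.map_apply measurable_inv_norm_smul measurableSet_closedBall,
    Measure.restrict_apply (hm _), Measure.restrict_apply (hm _),
    ← e.measurePreserving.measure_preimage ((hm (e x)).inter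
      measurableSet_ball).nullMeasurableSet]
  congr 1
  ext z
  simp only [Set.mem_inter_iff, Set.mem_preimage, Metric.mem_closedBall, Metric.mem_ball,
    dist_zero_right, LinearIsometryEquiv.norm_map, ← map_smul, LinearIsometryEquiv.dist_map]

theorem hausdorffMeasure_sphere_closedBall_eq {E : Type*} [NormedAddCommGroup E]
    [InnerProductSpace ℝ E] [MeasurableSpace E] [BorelSpace E] (d : ℝ) {x y : E}
    (h : ‖x‖ = ‖y‖) (r : ℝ) :
    (μH[d].restrict (Metric.sphere (0 : E) 1)) (Metric.closedBall x r) =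
      (μH[d].restrict (Metric.sphere (0 : E) 1)) (Metric.closedBall y r) := by
  obtain ⟨e, rfl⟩ := exists_linearIsometryEquiv_apply_eq h
  rw [Measure.restrict_apply measurableSet_closedBall,
    Measure.restrict_apply measurableSet_closedBall,
    ← e.toIsometryEquiv.hausdorffMeasure_image d (Metric.closedBall x r ∩ _)]
  congr 1
  rw [LinearIsometryEquiv.coe_toIsometryEquiv, Set.image_inter e.injective]
  simp [LinearIsometryEquiv.image_closedBall, LinearIsometryEquiv.image_sphere]

/-- On the unit sphere, a Hausdorff measure of finite total mass is proportional to the cone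
measure. -/
theorem hausdorffMeasure_mul_coneMeasure_sphere [Nontrivial E] (d : ℝ)
    (hfin : μH[d] (Metric.sphere (0 : E) 1) ≠ ∞) {s : Set E} (hs : s ⊆ Metric.sphere 0 1) :
    μH[d] s * coneMeasure E (Metric.sphere 0 1) =
      μH[d] (Metric.sphere (0 : E) 1) * coneMeasure E s := by
  have : IsFiniteMeasure (μH[d].restrict (Metric.sphere (0 : E) 1)) :=
    ⟨by simpa using hfin.lt_top⟩
  have := measure_mul_univ_eq_of_closedBall_eq (S := Metric.sphere (0 : E) 1)
    (ρ := μH[d].restrict (Metric.sphere (0 : E) 1)) (μ := coneMeasure E)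
    (by simp [Measure.restrict_apply Metric.isClosed_sphere.measurableSet.compl])
    coneMeasure_compl_sphere
    (fun x hx y hy r => hausdorffMeasure_sphere_closedBall_eq d
      (by rw [mem_sphere_zero_iff_norm.1 hx, mem_sphere_zero_iff_norm.1 hy]) r)
    (fun x hx y hy r => coneMeasure_closedBall_eq
      (by rw [mem_sphere_zero_iff_norm.1 hx, mem_sphere_zero_iff_norm.1 hy]) r) s
  rwa [Measure.restrict_eq_self _ hs, Measure.restrict_apply_univ,
    ← measure_add_measure_compl (μ := coneMeasure E) Metric.isClosed_sphere.measurableSet,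
    coneMeasure_compl_sphere, add_zero] at this

end Cone

section Frame

variable {n : ℕ}

/-- The linear coordinates on Euclidean space given by an orthonormal basis, with the first
coordinate split off. -/
noncomputable def frameMap (b : OrthonormalBasis (Fin (n + 1)) ℝ (EuclideanSpace ℝ (Fin (n + 1))))
    (p : ℝ × (Fin n → ℝ)) : EuclideanSpace ℝ (Fin (n + 1)) :=
  b.repr.symm (WithLp.toLp 2 (Fin.cons p.1 p.2))

variable (b : OrthonormalBasis (Fin (n + 1)) ℝ (EuclideanSpace ℝ (Fin (n + 1))))

theorem frameMap_add (p p' : ℝ × (Fin n → ℝ)) :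
    frameMap b (p + p') = frameMap b p + frameMap b p' := by
  rw [frameMap, frameMap, frameMap, ← map_add]
  congr 1
  ext i
  refine Fin.cases ?_ (fun j => ?_) i <;> simp

theorem frameMap_smul (c : ℝ) (p : ℝ × (Fin n → ℝ)) :
    frameMap b (c • p) = c • frameMap b p := by
  rw [frameMap, frameMap, ← map_smul]
  congr 1
  ext i
  refine Fin.cases ?_ (fun j => ?_) i <;> simp

theorem inner_frameMap_zero (p : ℝ × (Fin n → ℝ)) : ⟪frameMap b p, b 0⟫ = p.1 := by
  rw [real_inner_comm, ← OrthonormalBasis.repr_apply_apply]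
  simp [frameMap]

theorem inner_frameMap_succ (p : ℝ × (Fin n → ℝ)) (i : Fin n) :
    ⟪frameMap b p, b i.succ⟫ = p.2 i := by
  rw [real_inner_comm, ← OrthonormalBasis.repr_apply_apply]
  simp [frameMap]

theorem norm_sq_frameMap (p : ℝ × (Fin n → ℝ)) :
    ‖frameMap b p‖ ^ 2 = p.1 ^ 2 + euclNorm p.2 ^ 2 := by
  rw [frameMap, LinearIsometryEquiv.norm_map, euclNorm, EuclideanSpace.real_norm_sq_eq,
    EuclideanSpace.real_norm_sq_eq, Fin.sum_univ_succ]
  simp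

theorem measurePreserving_frameMap : MeasurePreserving (frameMap b) volume volume := by
  have h1 := (volume_preserving_piFinSuccAbove (fun _ : Fin (n + 1) => ℝ) 0).symm
  have h2 := PiLp.volume_preserving_toLp (Fin (n + 1))
  have h3 := b.repr.symm.measurePreserving
  have h : frameMap b = b.repr.symm ∘ WithLp.toLp 2 ∘
      (MeasurableEquiv.piFinSuccAbove (fun _ : Fin (n + 1) => ℝ) 0).symm := by
    funext p
    simp [frameMap, MeasurableEquiv.piFinSuccAbove, Fin.insertNthEquiv]
  rw [h]
  exact h3.comp (h2.comp h1)

theorem volume_inter_ball_eq_ballVolume {D : Set (EuclideanSpace ℝ (Fin (n + 1)))}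
    (hD : MeasurableSet D) :
    volume (D ∩ Metric.ball 0 1) = ballVolume (frameMap b ⁻¹' D) := by
  rw [← (measurePreserving_frameMap b).measure_preimage
    (hD.inter measurableSet_ball).nullMeasurableSet, ballVolume]
  congr 1
  ext p
  simp only [Set.mem_preimage, Set.mem_inter_iff, mem_ball_zero_iff, Set.mem_ofPred_eq,
    ← norm_sq_frameMap b, sq_lt_one_iff_abs_lt_one, abs_norm]

theorem coneMeasure_eq_ballVolume {D : Set (EuclideanSpace ℝ (Fin (n + 1)))}
    (hD : MeasurableSet D) (hcone : ∀ c : ℝ, 0 < c → ∀ z ∈ D, c • z ∈ D) :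
    coneMeasure _ (Metric.sphere 0 1 ∩ D) = ballVolume (frameMap b ⁻¹' D) := by
  rw [coneMeasure_sphere_inter hD hcone, volume_inter_ball_eq_ballVolume b hD]

/-- The solid double cone `{|⟪z, u⟫| ≤ a ‖z‖}`. -/
def tubeCone (u : EuclideanSpace ℝ (Fin (n + 1))) (a : ℝ) :
    Set (EuclideanSpace ℝ (Fin (n + 1))) :=
  {z | |⟪z, u⟫| ≤ a * ‖z‖}

theorem measurableSet_tubeCone (u : EuclideanSpace ℝ (Fin (n + 1))) (a : ℝ) :
    MeasurableSet (tubeCone u a) :=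
  measurableSet_le (by fun_prop) (by fun_prop)

theorem smul_mem_tubeCone {u : EuclideanSpace ℝ (Fin (n + 1))} {a c : ℝ} (hc : 0 < c)
    {z : EuclideanSpace ℝ (Fin (n + 1))} (hz : z ∈ tubeCone u a) : c • z ∈ tubeCone u a := by
  simp only [tubeCone, Set.mem_ofPred_eq, inner_smul_left, norm_smul, abs_mul,
    Real.norm_eq_abs, abs_of_pos hc] at hz ⊢
  simp only [conj_trivial, abs_of_pos hc]
  nlinarith

theorem frameMap_preimage_tubeCone (a : ℝ) :
    frameMap b ⁻¹' tubeCone (b 0) a = solidTube n a := by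
  ext p
  rw [Set.mem_preimage, tubeCone, solidTube, Set.mem_ofPred_eq, Set.mem_ofPred_eq,
    inner_frameMap_zero, ← norm_sq_frameMap b, Real.sqrt_sq (norm_nonneg _)]

theorem solidTube_one : solidTube n 1 = Set.univ := by
  refine Set.eq_univ_of_forall fun p => ?_
  rw [solidTube, Set.mem_ofPred_eq, one_mul]
  exact Real.abs_le_sqrt (le_add_of_nonneg_right (sq_nonneg _))

/-- Correlation inequality for a convex cone symmetric about the axis `ℝ (b (last n))` and the tube
around the hyperplane orthogonal to `b 0`. -/
theorem coneMeasure_mul_tubeCone_le (hn : 1 ≤ n) {D : Set (EuclideanSpace ℝ (Fin (n + 1)))}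
    (hD : MeasurableSet D) (hconv : Convex ℝ D) (hcone : ∀ c : ℝ, 0 < c → ∀ z ∈ D, c • z ∈ D)
    (hsymm : ∀ z ∈ D, (2 * ⟪z, b (Fin.last n)⟫) • b (Fin.last n) - z ∈ D) {a : ℝ} (ha0 : 0 < a)
    (ha1 : a ≤ 1) :
    coneMeasure _ (Metric.sphere 0 1 ∩ D) * coneMeasure _ (Metric.sphere 0 1 ∩ tubeCone (b 0) a) ≤
      coneMeasure _ (Metric.sphere 0 1 ∩ (D ∩ tubeCone (b 0) a)) *
        coneMeasure (EuclideanSpace ℝ (Fin (n + 1))) (Metric.sphere 0 1) := by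
  have hT := measurableSet_tubeCone (b 0) a
  rw [coneMeasure_eq_ballVolume b hD hcone,
    coneMeasure_eq_ballVolume b hT fun c hc z hz => smul_mem_tubeCone hc hz,
    coneMeasure_eq_ballVolume b (hD.inter hT)
      fun c hc z hz => ⟨hcone c hc z hz.1, smul_mem_tubeCone hc hz.2⟩,
    ← Set.inter_univ (Metric.sphere _ _),
    coneMeasure_eq_ballVolume b MeasurableSet.univ fun _ _ _ _ => Set.mem_univ _,
    Set.preimage_inter, frameMap_preimage_tubeCone, Set.preimage_univ]
  rcases ha1.eq_or_lt with rfl | ha1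
  · rw [solidTube_one, Set.inter_univ]
  refine ballVolume_mul_solidTube_le hn ((measurePreserving_frameMap b).measurable hD) ?_ ?_ ?_
    ha0 ha1
  · intro p hp q hq s t hs ht hst
    rw [Set.mem_preimage, frameMap_add, frameMap_smul, frameMap_smul]
    exact hconv hp hq hs ht hst
  · intro c hc p hp
    rw [Set.mem_preimage, frameMap_smul]
    exact hcone c hc _ hp
  · obtain ⟨m, rfl⟩ : ∃ m, n = m + 1 := ⟨n - 1, by omega⟩
    have hR : MeasurePreserving
        (fun (x : Fin (m + 1) → ℝ) i => if i = Fin.last m then x i else -x i) := by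
      refine volume_preserving_pi (f := fun i (t : ℝ) => if i = Fin.last m then t else -t)
        fun i => ?_
      by_cases hi : i = Fin.last m
      · simp only [hi, if_true]
        exact MeasurePreserving.id volume
      · simpa [hi] using Measure.measurePreserving_neg volume
    set R : (Fin (m + 1) → ℝ) → Fin (m + 1) → ℝ := fun x i => if i = Fin.last m then x i else -x i
    have hRR : ∀ x, R (R x) = x := fun x => by
      ext i
      by_cases hi : i = Fin.last m <;> simp [R, hi]
    have hRn : ∀ x, euclNorm (R x) = euclNorm x := fun x => by
      rw [euclNorm, euclNorm, EuclideanSpace.norm_eq, EuclideanSpace.norm_eq]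
      congr 1
      refine Finset.sum_congr rfl fun i _ => ?_
      by_cases hi : i = Fin.last m <;> simp [R, hi]
    have hRC : ∀ s x, (s, x) ∈ frameMap b ⁻¹' D → (-s, R x) ∈ frameMap b ⁻¹' D := by
      intro s x hx
      rw [Set.mem_preimage]
      convert hsymm _ hx using 1
      refine b.repr.injective (PiLp.ext fun i => ?_)
      rw [OrthonormalBasis.repr_apply_apply, OrthonormalBasis.repr_apply_apply, inner_sub_right,
        inner_smul_right, orthonormal_iff_ite.1 b.orthonormal, real_inner_comm,
        real_inner_comm (frameMap b (s, x)) (b i), ← Fin.succ_last, inner_frameMap_succ]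
      refine Fin.cases ?_ (fun j => ?_) i
      · rw [inner_frameMap_zero, inner_frameMap_zero, if_neg (Fin.succ_ne_zero _).symm]
        simp
      · rw [inner_frameMap_succ, inner_frameMap_succ]
        by_cases hj : j = Fin.last m
        · simp [R, hj]
          ring
        · simp [R, hj]
    intro s
    have hmeas := measurableSet_ballSlice ((measurePreserving_frameMap b).measurable hD) (-s) 1
    rw [← hR.measure_preimage hmeas.nullMeasurableSet]
    congr 1
    ext x
    simp only [ballSlice, Set.mem_preimage (s := {x | _}), Set.mem_ofPred_eq, hRn]
    refine and_congr ⟨fun h => ?_, hRC s x⟩ Iff.rfl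
    have := hRC _ _ h
    rwa [hRR, neg_neg] at this

end Frame

section ConeOver

variable {n : ℕ}

/-- The point `(x, 1)`. -/
noncomputable def homogLift (x : EuclideanSpace ℝ (Fin n)) : EuclideanSpace ℝ (Fin (n + 1)) :=
  (EuclideanSpace.equiv (Fin (n + 1)) ℝ).symm (Fin.snoc (fun i => x i) 1)

@[simp]
theorem homogLift_castSucc (x : EuclideanSpace ℝ (Fin n)) (i : Fin n) :
    homogLift x i.castSucc = x i := by
  simp [homogLift]

@[simp]
theorem homogLift_last (x : EuclideanSpace ℝ (Fin n)) : homogLift x (Fin.last n) = 1 := by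
  simp [homogLift]

theorem continuous_homogLift : Continuous (homogLift (n := n)) := by
  refine (PiLp.continuous_toLp 2 _).comp (continuous_pi fun i => ?_)
  refine Fin.lastCases ?_ (fun j => ?_) i
  · simpa using continuous_const
  · simp only [Fin.snoc_castSucc]
    fun_prop

theorem norm_homogLift (x : EuclideanSpace ℝ (Fin n)) : ‖homogLift x‖ = √(1 + ‖x‖ ^ 2) := by
  rw [EuclideanSpace.norm_eq, Fin.sum_univ_castSucc, EuclideanSpace.norm_sq_eq]
  simp [add_comm]

/-- The first `n` coordinates of a vector. -/
noncomputable def initVec (z : EuclideanSpace ℝ (Fin (n + 1))) : EuclideanSpace ℝ (Fin n) :=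
  WithLp.toLp 2 fun i => z i.castSucc

theorem continuous_initVec : Continuous (initVec (n := n)) :=
  (PiLp.continuous_toLp 2 _).comp (continuous_pi fun i => by fun_prop)

/-- The open cone spanned by `K × {1}`. -/
def coneOver (K : Set (EuclideanSpace ℝ (Fin n))) : Set (EuclideanSpace ℝ (Fin (n + 1))) :=
  {z | 0 < z (Fin.last n) ∧ (z (Fin.last n))⁻¹ • initVec z ∈ K}

theorem eq_last_smul_homogLift {z : EuclideanSpace ℝ (Fin (n + 1))} (hz : 0 < z (Fin.last n)) :
    z = z (Fin.last n) • homogLift ((z (Fin.last n))⁻¹ • initVec z) := by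
  ext i
  refine Fin.lastCases ?_ (fun j => ?_) i
  · simp
  · simp [initVec, hz.ne']

theorem smul_homogLift_mem_coneOver {t : ℝ} (ht : 0 < t) {K : Set (EuclideanSpace ℝ (Fin n))}
    {x : EuclideanSpace ℝ (Fin n)} : t • homogLift x ∈ coneOver K ↔ x ∈ K := by
  have h : (t⁻¹ • initVec (t • homogLift x) : EuclideanSpace ℝ (Fin n)) = x := by
    ext i
    simp [initVec, ht.ne']
  simp [coneOver, ht, h]

theorem image_gnomonic_eq (K : Set (EuclideanSpace ℝ (Fin n))) :
    gnomonic n '' K = Metric.sphere 0 1 ∩ coneOver K := by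
  have hpos : ∀ x : EuclideanSpace ℝ (Fin n), 0 < √(1 + ‖x‖ ^ 2) := fun x => by positivity
  ext z
  constructor
  · rintro ⟨x, hx, rfl⟩
    change (√(1 + ‖x‖ ^ 2))⁻¹ • homogLift x ∈ _
    refine ⟨?_, (smul_homogLift_mem_coneOver (inv_pos.2 (hpos x))).2 hx⟩
    rw [mem_sphere_zero_iff_norm, norm_smul, norm_inv, norm_homogLift,
      Real.norm_of_nonneg (hpos x).le, inv_mul_cancel₀ (hpos x).ne']
  · rintro ⟨hz, hz0, hzK⟩
    refine ⟨_, hzK, ?_⟩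
    set x := (z (Fin.last n))⁻¹ • initVec z
    have hzx : z = z (Fin.last n) • homogLift x := eq_last_smul_homogLift hz0
    rw [mem_sphere_zero_iff_norm, hzx, norm_smul, norm_homogLift, Real.norm_of_nonneg hz0.le] at hz
    change (√(1 + ‖x‖ ^ 2))⁻¹ • homogLift x = _
    rw [← eq_inv_of_mul_eq_one_left hz, ← hzx]

theorem measurableSet_coneOver {K : Set (EuclideanSpace ℝ (Fin n))} (hK : MeasurableSet K) :
    MeasurableSet (coneOver K) := by
  have h0 : Measurable fun z : EuclideanSpace ℝ (Fin (n + 1)) => z (Fin.last n) := by fun_prop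
  exact (measurableSet_lt measurable_const h0).inter
    ((h0.inv.smul continuous_initVec.measurable) hK)

theorem isOpen_coneOver {K : Set (EuclideanSpace ℝ (Fin n))} (hK : IsOpen K) :
    IsOpen (coneOver K) := by
  have h0 : Continuous fun z : EuclideanSpace ℝ (Fin (n + 1)) => z (Fin.last n) := by fun_prop
  exact ContinuousOn.isOpen_inter_preimage
    ((h0.continuousOn.inv₀ fun z hz => ne_of_gt hz).smul continuous_initVec.continuousOn)
    (isOpen_lt continuous_const h0) hK

theorem smul_mem_coneOver {K : Set (EuclideanSpace ℝ (Fin n))} {c : ℝ} (hc : 0 < c)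
    {z : EuclideanSpace ℝ (Fin (n + 1))} (hz : z ∈ coneOver K) : c • z ∈ coneOver K := by
  rw [eq_last_smul_homogLift hz.1, smul_smul, smul_homogLift_mem_coneOver (mul_pos hc hz.1)]
  exact hz.2

theorem convex_coneOver {K : Set (EuclideanSpace ℝ (Fin n))} (hK : Convex ℝ K) :
    Convex ℝ (coneOver K) := by
  refine convex_iff_forall_pos.2 fun z hz w hw a b ha hb _ => ?_
  have hz' := mul_pos ha hz.1
  have hw' := mul_pos hb hw.1
  have hlast : (a • z + b • w) (Fin.last n) = a * z (Fin.last n) + b * w (Fin.last n) := by simp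
  have h0 : 0 < a * z (Fin.last n) + b * w (Fin.last n) := add_pos hz' hw'
  refine ⟨hlast ▸ h0, ?_⟩
  rw [hlast]
  convert convex_iff_div.1 hK hz.2 hw.2 hz'.le hw'.le h0 using 1
  ext i
  have := hz.1.ne'
  have := hw.1.ne'
  simp [initVec]
  field_simp

theorem inner_pole (z : EuclideanSpace ℝ (Fin (n + 1))) : ⟪z, pole n⟫ = z (Fin.last n) := by
  rw [pole, EuclideanSpace.inner_single_right]
  simp

theorem reflection_mem_coneOver {K : Set (EuclideanSpace ℝ (Fin n))} (hK : ∀ x ∈ K, -x ∈ K)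
    {z : EuclideanSpace ℝ (Fin (n + 1))} (hz : z ∈ coneOver K) :
    (2 * ⟪z, pole n⟫) • pole n - z ∈ coneOver K := by
  have hlast : ((2 * ⟪z, pole n⟫) • pole n - z) (Fin.last n) = z (Fin.last n) := by
    rw [inner_pole]
    simp [pole]
    ring
  refine ⟨hlast ▸ hz.1, ?_⟩
  rw [hlast]
  convert hK _ hz.2 using 1
  ext i
  simp [initVec, pole]

theorem coneOver_frontier_subset (K : Set (EuclideanSpace ℝ (Fin n))) :
    coneOver (frontier K) ⊆ frontier (coneOver K) := by
  intro z hz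
  have hpre : (fun x => z (Fin.last n) • homogLift x) ⁻¹' coneOver K = K :=
    Set.ext fun x => smul_homogLift_mem_coneOver hz.1
  have h : Continuous fun x : EuclideanSpace ℝ (Fin n) => z (Fin.last n) • homogLift x := by
    have := continuous_homogLift (n := n)
    fun_prop
  have h := h.frontier_preimage_subset (coneOver K)
  rw [hpre] at h
  rw [eq_last_smul_homogLift hz.1]
  exact h hz.2

theorem coneMeasure_image_gnomonic_frontier {K : Set (EuclideanSpace ℝ (Fin n))}
    (hK : Convex ℝ K) : coneMeasure _ (gnomonic n '' frontier K) = 0 := by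
  rw [image_gnomonic_eq, coneMeasure_sphere_inter
    (measurableSet_coneOver isClosed_frontier.measurableSet) fun c hc z hz =>
      smul_mem_coneOver hc hz]
  exact measure_mono_null (Set.inter_subset_left.trans (coneOver_frontier_subset K))
    ((convex_coneOver hK).addHaar_frontier volume)

theorem coneMeasure_image_gnomonic_interior_inter {K : Set (EuclideanSpace ℝ (Fin n))}
    (hK : Convex ℝ K) (T : Set (EuclideanSpace ℝ (Fin (n + 1)))) :
    coneMeasure _ (gnomonic n '' K ∩ T) = coneMeasure _ (gnomonic n '' interior K ∩ T) := by
  refine le_antisymm ?_ (measure_mono (by gcongr; exact interior_subset))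
  refine (measure_mono ?_).trans (measure_union_le (gnomonic n '' interior K ∩ T)
    (gnomonic n '' frontier K)) |>.trans_eq ?_
  · rintro _ ⟨⟨x, hx, rfl⟩, hT⟩
    by_cases hxi : x ∈ interior K
    · exact Or.inl ⟨⟨x, hxi, rfl⟩, hT⟩
    · exact Or.inr ⟨x, ⟨subset_closure hx, hxi⟩, rfl⟩
  · rw [coneMeasure_image_gnomonic_frontier hK, add_zero]

theorem coneMeasure_image_gnomonic_ne_zero {K : Set (EuclideanSpace ℝ (Fin n))}
    (hK : (interior K).Nonempty) : coneMeasure _ (gnomonic n '' K) ≠ 0 := by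
  refine ne_of_gt (lt_of_lt_of_le ?_ (measure_mono (Set.image_mono interior_subset)))
  rw [image_gnomonic_eq, coneMeasure_sphere_inter
    (measurableSet_coneOver isOpen_interior.measurableSet) fun c hc z hz =>
      smul_mem_coneOver hc hz]
  refine ((isOpen_coneOver isOpen_interior).inter Metric.isOpen_ball).measure_pos _ ?_
  obtain ⟨x, hx⟩ := hK
  have hpos : 0 < 1 + ‖homogLift x‖ := by positivity
  refine ⟨(1 + ‖homogLift x‖)⁻¹ • homogLift x,
    (smul_homogLift_mem_coneOver (inv_pos.2 hpos)).2 hx, ?_⟩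
  rw [mem_ball_zero_iff, norm_smul, norm_inv, Real.norm_of_nonneg hpos.le, inv_mul_lt_one₀ hpos]
  linarith

theorem exists_orthonormalBasis_zero_last (hn : 1 ≤ n) {u o : EuclideanSpace ℝ (Fin (n + 1))}
    (hu : ‖u‖ = 1) (ho : ‖o‖ = 1) (huo : ⟪u, o⟫ = 0) :
    ∃ b : OrthonormalBasis (Fin (n + 1)) ℝ (EuclideanSpace ℝ (Fin (n + 1))),
      b 0 = u ∧ b (Fin.last n) = o := by
  have h0l : Fin.last n ≠ 0 := fun h => by
    have := congrArg Fin.val h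
    simp at this
    omega
  let v : Fin (n + 1) → EuclideanSpace ℝ (Fin (n + 1)) :=
    fun i => if i = 0 then u else if i = Fin.last n then o else 0
  have hv0 : v 0 = u := by simp [v]
  have hvl : v (Fin.last n) = o := by simp [v, h0l]
  have hv : Pairwise fun i j => ⟪v i, v j⟫ = 0 := by
    intro i j hij
    have hou : ⟪o, u⟫ = 0 := by rw [real_inner_comm, huo]
    by_cases hi : i = 0 <;> by_cases hj : j = 0 <;> by_cases hi' : i = Fin.last n <;>
      by_cases hj' : j = Fin.last n <;> simp_all [v]
  have hcard : Module.finrank ℝ (EuclideanSpace ℝ (Fin (n + 1))) = Fintype.card (Fin (n + 1)) := by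
    simp
  refine ⟨InnerProductSpace.gramSchmidtOrthonormalBasis hcard v, ?_, ?_⟩
  · rw [InnerProductSpace.gramSchmidtOrthonormalBasis_apply_of_orthogonal hcard hv, hv0, hu]
    · simp
    · rw [hv0, ← norm_ne_zero_iff, hu]
      exact one_ne_zero
  · rw [InnerProductSpace.gramSchmidtOrthonormalBasis_apply_of_orthogonal hcard hv, hvl, ho]
    · simp
    · rw [hvl, ← norm_ne_zero_iff, ho]
      exact one_ne_zero

theorem sphere_inter_tubeCone (u : EuclideanSpace ℝ (Fin (n + 1))) (a : ℝ) :
    Metric.sphere 0 1 ∩ tubeCone u a = {y ∈ unitSphereSet n | |⟪y, u⟫| ≤ a} := by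
  ext y
  simp only [tubeCone, unitSphereSet, Set.mem_inter_iff, Set.mem_ofPred_eq,
    mem_sphere_zero_iff_norm]
  refine and_congr_right fun hy => ?_
  rw [hy, mul_one]

theorem coneMeasure_image_gnomonic_mul_tube_le (hn : 1 ≤ n)
    {K : Set (EuclideanSpace ℝ (Fin n))} (hconv : Convex ℝ K) (hsymm : K = -K)
    {u : EuclideanSpace ℝ (Fin (n + 1))} (hu : ‖u‖ = 1) (huo : ⟪u, pole n⟫ = 0) {a : ℝ}
    (ha0 : 0 < a) (ha1 : a ≤ 1) :
    coneMeasure _ (gnomonic n '' K) * coneMeasure _ {y ∈ unitSphereSet n | |⟪y, u⟫| ≤ a} ≤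
      coneMeasure _ (gnomonic n '' K ∩ {y ∈ unitSphereSet n | |⟪y, u⟫| ≤ a}) *
        coneMeasure _ (unitSphereSet n) := by
  obtain ⟨b, hb0, hbl⟩ := exists_orthonormalBasis_zero_last hn hu (o := pole n) (by simp [pole]) huo
  have hneg : ∀ x ∈ interior K, -x ∈ interior K := fun x hx => by
    have h : (Homeomorph.neg _) ⁻¹' interior K = interior K := by
      rw [Homeomorph.preimage_interior]
      exact congrArg interior hsymm.symm
    rw [← h] at hx
    exact hx
  have h := coneMeasure_mul_tubeCone_le b hn
    (measurableSet_coneOver isOpen_interior.measurableSet) (convex_coneOver hconv.interior)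
    (fun c hc z hz => smul_mem_coneOver hc hz)
    (fun z hz => hbl ▸ reflection_mem_coneOver hneg hz) ha0 ha1
  have hK := coneMeasure_image_gnomonic_interior_inter hconv Set.univ
  rw [Set.inter_univ, Set.inter_univ] at hK
  rw [hK, coneMeasure_image_gnomonic_interior_inter hconv, image_gnomonic_eq,
    ← sphere_inter_tubeCone, ← Set.inter_inter_distrib_left, ← hb0]
  exact h

end ConeOver

/-- Correlation of a symmetric convex spherical body with a
codimension-one tube: for `K = q(K₀)` and the `ε`-tube `T` around the great hypersphere
`Sⁿ ∩ u^⊥` through the pole, `μ_n(K ∩ T)/μ_n(K) ≥ μ_n(T)/μ_n(Sⁿ)`. -/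
theorem convex_body_tube_correlation (n : ℕ) (hn : 1 ≤ n)
    (K₀ : Set (EuclideanSpace ℝ (Fin n))) (hK₀conv : Convex ℝ K₀) (hK₀sym : K₀ = -K₀)
    (hK₀bdd : Bornology.IsBounded K₀) (hK₀int : (interior K₀).Nonempty)
    (u : EuclideanSpace ℝ (Fin (n + 1))) (hu : ‖u‖ = 1) (huo : ⟪u, pole n⟫ = 0)
    (ε : ℝ) (hε : ε ∈ Set.Ioc 0 (π / 2)) :
    μH[(n : ℝ)] ((gnomonic n '' K₀) ∩ {y ∈ unitSphereSet n | |⟪y, u⟫| ≤ Real.sin ε}) /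
        μH[(n : ℝ)] (gnomonic n '' K₀) ≥
      μH[(n : ℝ)] {y ∈ unitSphereSet n | |⟪y, u⟫| ≤ Real.sin ε} /
        μH[(n : ℝ)] (unitSphereSet n) := by
  have hle := coneMeasure_image_gnomonic_mul_tube_le hn hK₀conv hK₀sym hu huo
    (Real.sin_pos_of_pos_of_lt_pi hε.1 (by linarith [hε.2, Real.pi_pos])) (Real.sin_le_one ε)
  have hK0 := coneMeasure_image_gnomonic_ne_zero hK₀int
  have hKS : gnomonic n '' K₀ ⊆ Metric.sphere 0 1 := by
    rw [image_gnomonic_eq]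
    exact Set.inter_subset_left
  have hTS : {y ∈ unitSphereSet n | |⟪y, u⟫| ≤ Real.sin ε} ⊆ Metric.sphere 0 1 := fun y hy => hy.1
  generalize {y ∈ unitSphereSet n | |⟪y, u⟫| ≤ Real.sin ε} = T at hle hTS ⊢
  generalize gnomonic n '' K₀ = K at hle hK0 hKS ⊢
  change μH[(n : ℝ)] T / μH[(n : ℝ)] (Metric.sphere 0 1) ≤ _
  by_cases hfin : μH[(n : ℝ)] (Metric.sphere (0 : EuclideanSpace ℝ (Fin (n + 1))) 1) = ∞
  · simp [hfin]
  by_cases hzero : μH[(n : ℝ)] (Metric.sphere (0 : EuclideanSpace ℝ (Fin (n + 1))) 1) = 0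
  · simp [measure_mono_null hTS hzero]
  set ν := coneMeasure (EuclideanSpace ℝ (Fin (n + 1)))
  have hS0 : ν (Metric.sphere 0 1) ≠ 0 := fun h => hK0 (measure_mono_null hKS h)
  obtain ⟨c, hc0, hct, hc⟩ : ∃ c : ℝ≥0∞, c ≠ 0 ∧ c ≠ ∞ ∧
      ∀ A ⊆ Metric.sphere (0 : EuclideanSpace ℝ (Fin (n + 1))) 1, μH[(n : ℝ)] A = c * ν A := by
    refine ⟨_, (ENNReal.div_pos hzero (measure_ne_top ν (Metric.sphere 0 1))).ne',
      ENNReal.div_ne_top hfin hS0, fun A hA => ?_⟩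
    rw [ENNReal.mul_comm_div, ← mul_div_assoc, ENNReal.eq_div_iff hS0 (measure_ne_top _ _),
      mul_comm, hausdorffMeasure_mul_coneMeasure_sphere n hfin hA]
  rw [hc _ (Set.inter_subset_left.trans hKS), hc _ hKS, hc _ hTS, hc _ subset_rfl,
    ENNReal.mul_div_mul_left _ _ hc0 hct, ENNReal.mul_div_mul_left _ _ hc0 hct,
    ENNReal.div_le_iff hS0 (measure_ne_top _ _), ENNReal.mul_comm_div, ← mul_div_assoc,
    ENNReal.le_div_iff_mul_le (Or.inl hK0) (Or.inl (measure_ne_top _ _)), mul_comm]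
  exact hle
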